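/- Let G_w be the weak closure of some OTG with n ≥ 5 vertices. Then h(G_w) = n/2 if and only if n is even and G_w is isomorphic to K_{n/2} ∨ K^c_{n/2} or to the complete bipartite graph K_{n/2,n/2}. -/

import Mathlib

open Finset SimpleGraph
open scoped Classical

/-- `X` is a Hamiltonian cycle enforcing set (H-force set) of `G`: `X` is nonempty and
every cycle of `G` containing all vertices of `X` is a Hamiltonian cycle. -/
def IsHForceSet {V : Type*} [Fintype V] [DecidableEq V] (G : SimpleGraph V)
    (X : Finset V) : Prop :=
  X.Nonempty ∧ ∀ (v : V) (c : G.Walk v v), c.IsCycle → (∀ x ∈ X, x ∈ c.support) →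
    c.IsHamiltonianCycle

/-- The H-force number of `G`: the smallest cardinality of an H-force set of `G`. -/
noncomputable def hForce {V : Type*} [Fintype V] [DecidableEq V] (G : SimpleGraph V) : ℕ :=
  sInf {k | ∃ X : Finset V, IsHForceSet G X ∧ X.card = k}

/-- `G` satisfies the condition of Ore's theorem: `d(u) + d(v) ≥ n` for every pair of
nonadjacent vertices `u, v`. -/
def IsOTG {V : Type*} [Fintype V] (G : SimpleGraph V) : Prop :=
  ∀ u v : V, u ≠ v → ¬G.Adj u v → Fintype.card V ≤ G.degree u + G.degree v

/-- One step of the weak-closure process: `H` is obtained from `G` by joining one pair of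
nonadjacent vertices whose degree sum is at least `n + 1`. -/
def WeakStep {V : Type*} [Fintype V] (G H : SimpleGraph V) : Prop :=
  ∃ u v : V, u ≠ v ∧ ¬G.Adj u v ∧ Fintype.card V + 1 ≤ G.degree u + G.degree v ∧
    H = G ⊔ SimpleGraph.edge u v

/-- `H` is a weak closure of `G`: it is obtained from `G` by a finite sequence of weak-closure
steps, and no pair of nonadjacent vertices of `H` has degree sum at least `n + 1`. -/
def IsWeakClosure {V : Type*} [Fintype V] (G H : SimpleGraph V) : Prop :=
  Relation.ReflTransGen WeakStep G H ∧
    ∀ u v : V, u ≠ v → ¬H.Adj u v → H.degree u + H.degree v < Fintype.card V + 1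

/-- The join `G ∨ H` of two graphs on disjoint vertex sets: their disjoint union together
with all edges between the two sides. -/
def graphJoin {α β : Type*} (G : SimpleGraph α) (H : SimpleGraph β) : SimpleGraph (α ⊕ β) :=
  (G ⊕g H) ⊔ completeBipartiteGraph α β

section HamiltonianCycles

/-- The list `l` runs from `a` to `b`, consecutive entries being `R`-related. -/
structure IsPathList {α : Type*} (R : α → α → Prop) (a b : α) (l : List α) : Prop where
  head : l.head? = some a
  getLast : l.getLast? = some b
  chain : l.IsChain R

namespace IsPathList

variable {α : Type*} {R : α → α → Prop} {a b c d : α} {l l' : List α}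

lemma singleton (R : α → α → Prop) (a : α) : IsPathList R a a [a] := ⟨rfl, rfl, by simp⟩

lemma append (h : IsPathList R a b l) (h' : IsPathList R c d l') (hbc : R b c) :
    IsPathList R a d (l ++ l') where
  head := by simp [h.head]
  getLast := by simp [h'.getLast]
  chain := by
    refine List.isChain_append.2 ⟨h.chain, h'.chain, ?_⟩
    simp [h.getLast, h'.head, hbc]

lemma reverse (hR : ∀ a b, R a b → R b a) (h : IsPathList R a b l) :
    IsPathList R b a l.reverse where
  head := by simp [h.getLast]
  getLast := by simp [h.head]
  chain := List.isChain_reverse.2 (h.chain.imp fun a b => hR a b)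

lemma map {β : Type*} (f : α → β) {S : β → β → Prop}
    (h : IsPathList (fun a b => S (f a) (f b)) a b l) :
    IsPathList S (f a) (f b) (l.map f) where
  head := by simp [h.head]
  getLast := by simp [h.getLast]
  chain := (List.isChain_map f).2 h.chain

end IsPathList

/-- The increasing list of the integers from `i` to `j`. -/
def upList (i j : ℕ) : List ℕ := List.range' i (j + 1 - i)

lemma mem_upList {i j k : ℕ} : k ∈ upList i j ↔ i ≤ k ∧ k ≤ j := by
  simp only [upList, List.mem_range'_1]; omega

lemma nodup_upList (i j : ℕ) : (upList i j).Nodup := List.nodup_range'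

lemma length_upList (i j : ℕ) : (upList i j).length = j + 1 - i := by simp [upList]

lemma isPathList_upList {R : ℕ → ℕ → Prop} {i j : ℕ} (hij : i ≤ j)
    (h : ∀ k, i ≤ k → k < j → R k (k + 1)) : IsPathList R i j (upList i j) := by
  induction j, hij using Nat.le_induction with
  | base => simpa [upList] using IsPathList.singleton R i
  | succ j hij ih =>
    have : upList i (j + 1) = upList i j ++ [j + 1] := by
      rw [upList, upList, show j + 1 + 1 - i = (j + 1 - i) + 1 by omega, List.range'_concat]
      congr 2; omega
    rw [this]
    exact (ih fun k h1 h2 => h k h1 (by omega)).append (.singleton R _) (h j hij (by omega))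

variable {V : Type*}

/-- The list `l` enumerates the vertices of a cycle of `G` in cyclic order. -/
structure IsCycleList (G : SimpleGraph V) (l : List V) : Prop where
  nodup : l.Nodup
  three_le : 3 ≤ l.length
  closed : ∃ a b, IsPathList G.Adj a b l ∧ G.Adj b a

lemma IsCycleList.exists_isCycle {G : SimpleGraph V} {l : List V} (h : IsCycleList G l) :
    ∃ (v : V) (c : G.Walk v v), c.IsCycle ∧ ∀ x, x ∈ c.support ↔ x ∈ l := by
  obtain ⟨a, b, hp, hab⟩ := h.closed
  have hne : l ≠ [] := by rintro rfl; simpa using h.three_le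
  have h1 : l.head hne = a := by
    have := hp.head; rw [List.head?_eq_some_head hne] at this; simpa using this
  have h2 : l.getLast hne = b := by
    have := hp.getLast; rw [List.getLast?_eq_some_getLast hne] at this; simpa using this
  have hadj : G.Adj (l.getLast hne) (l.head hne) := by rwa [h1, h2]
  refine ⟨_, .cons hadj (.ofSupport l hne hp.chain), ?_, ?_⟩
  · rw [Walk.isCycle_iff_isPath_tail_and_le_length]
    refine ⟨?_, ?_⟩
    · simp [Walk.isPath_def, h.nodup]
    · have := h.three_le
      simp; omega
  · intro x
    simp only [Walk.support_cons, Walk.support_ofSupport, List.mem_cons, or_iff_right_iff_imp]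
    rintro rfl
    exact List.getLast_mem hne

lemma isCycleList_map {G : SimpleGraph V} (p : ℕ → V) {L : List ℕ} {a b : ℕ}
    (hinj : ∀ i ∈ L, ∀ j ∈ L, p i = p j → i = j) (hL : L.Nodup) (hlen : 3 ≤ L.length)
    (hp : IsPathList (fun i j => G.Adj (p i) (p j)) a b L) (hab : G.Adj (p b) (p a)) :
    IsCycleList G (L.map p) where
  nodup := List.Nodup.map_on hinj hL
  three_le := by simpa using hlen
  closed := ⟨_, _, hp.map p, hab⟩

/-- `c` is a periodic enumeration of the vertices of a cycle of length `M` of `G`. -/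
structure IsCycleSeq (G : SimpleGraph V) (M : ℕ) (c : ℕ → V) : Prop where
  three_le : 3 ≤ M
  adj : ∀ i, G.Adj (c i) (c (i + 1))
  periodic : ∀ i, c (i + M) = c i
  inj : ∀ i j, i < j → j < i + M → c i ≠ c j

lemma IsCycleSeq.inj' {G : SimpleGraph V} {M : ℕ} {c : ℕ → V} (h : IsCycleSeq G M c) {i j : ℕ}
    (h1 : i < j + M) (h2 : j < i + M) (hij : c i = c j) : i = j := by
  rcases lt_trichotomy i j with hlt | rfl | hlt
  · exact absurd hij (h.inj i j hlt h2)
  · rfl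
  · exact absurd hij.symm (h.inj j i hlt h1)

lemma IsCycleList.exists_isCycleSeq {G : SimpleGraph V} {l : List V} (h : IsCycleList G l) :
    ∃ c, IsCycleSeq G l.length c ∧ ∀ x, x ∈ l ↔ ∃ i < l.length, c i = x := by
  obtain ⟨a, b, hp, hab⟩ := h.closed
  have h3 := h.three_le
  have hpos : 0 < l.length := by omega
  have hlt : ∀ i, i % l.length < l.length := fun i => Nat.mod_lt i hpos
  refine ⟨fun i => l[i % l.length]'(hlt i), ⟨h3, ?_, ?_, ?_⟩, ?_⟩
  · intro i
    by_cases hi : i % l.length + 1 < l.length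
    · have : (i + 1) % l.length = i % l.length + 1 := by
        rw [Nat.add_mod, Nat.mod_eq_of_lt (a := 1) (by omega), Nat.mod_eq_of_lt hi]
      simp only [this]
      exact List.isChain_iff_getElem.1 hp.chain _ hi
    · have h1 : i % l.length = l.length - 1 := by have := hlt i; omega
      have h2 : (i + 1) % l.length = 0 := by
        rw [Nat.add_mod, Nat.mod_eq_of_lt (a := 1) (by omega), h1,
          show l.length - 1 + 1 = l.length by omega, Nat.mod_self]
      simp only [h1, h2]
      have e1 : l[l.length - 1] = b := by
        have := hp.getLast
        rw [List.getLast?_eq_getElem?, List.getElem?_eq_getElem (by omega)] at this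
        simpa using this
      have e2 : l[0] = a := by
        have := hp.head
        rw [List.head?_eq_getElem?, List.getElem?_eq_getElem (by omega)] at this
        simpa using this
      rwa [e1, e2]
  · intro i; simp
  · intro i j hij hj he
    have := (List.Nodup.getElem_inj_iff h.nodup).1 he
    have h4 : (j - i) % l.length = 0 := Nat.sub_mod_eq_zero_of_mod_eq this.symm
    rw [Nat.mod_eq_of_lt (by omega)] at h4
    omega
  · intro x
    rw [List.mem_iff_getElem]
    constructor
    · rintro ⟨i, hi, rfl⟩
      exact ⟨i, hi, by simp [Nat.mod_eq_of_lt hi]⟩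
    · rintro ⟨i, hi, rfl⟩
      exact ⟨_, hlt i, rfl⟩

lemma degree_le_card_filter_add [Fintype V] (G : SimpleGraph V) (v : V) (p : ℕ → V) (S : Finset ℕ)
    (hinj : Set.InjOn p S) :
    G.degree v ≤ #{i ∈ S | G.Adj v (p i)} + (Fintype.card V - #S) := by
  have hsub : G.neighborFinset v ⊆ ({i ∈ S | G.Adj v (p i)}).image p ∪ (S.image p)ᶜ := by
    intro w hw
    rw [mem_neighborFinset] at hw
    simp only [Finset.mem_union, Finset.mem_image, Finset.mem_filter, Finset.mem_compl]
    by_cases h : ∃ i ∈ S, p i = w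
    · obtain ⟨i, hi, rfl⟩ := h
      exact Or.inl ⟨i, ⟨hi, hw⟩, rfl⟩
    · exact Or.inr h
  rw [← card_neighborFinset_eq_degree]
  refine (card_le_card hsub).trans ((card_union_le _ _).trans ?_)
  rw [card_compl, card_image_of_injOn hinj]
  gcongr
  exact card_image_le

lemma degree_add_degree_le_of_no_crossing [Fintype V] (G : SimpleGraph V) (p : ℕ → V) (N : ℕ)
    (hinj : Set.InjOn p (Finset.Icc 1 N))
    (hno : ∀ i, 1 ≤ i → i < N → G.Adj (p 1) (p (i + 1)) → ¬G.Adj (p N) (p i)) :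
    G.degree (p 1) + G.degree (p N) ≤ N - 1 + 2 * (Fintype.card V - N) ∧
      (N - 1 + 2 * (Fintype.card V - N) ≤ G.degree (p 1) + G.degree (p N) →
        ∀ i, 1 ≤ i → i < N → G.Adj (p 1) (p (i + 1)) ∨ G.Adj (p N) (p i)) := by
  have h1 := degree_le_card_filter_add G (p 1) p (Finset.Icc 1 N) hinj
  have h2 := degree_le_card_filter_add G (p N) p (Finset.Icc 1 N) hinj
  set A : Finset ℕ := {i ∈ Finset.Icc 1 N | G.Adj (p 1) (p i)} with hA
  set B : Finset ℕ := {i ∈ Finset.Icc 1 N | G.Adj (p N) (p i)} with hB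
  have hmemA : ∀ i, i ∈ A ↔ (1 ≤ i ∧ i ≤ N) ∧ G.Adj (p 1) (p i) := by simp [hA]
  have hmemB : ∀ i, i ∈ B ↔ (1 ≤ i ∧ i ≤ N) ∧ G.Adj (p N) (p i) := by simp [hB]
  have hcB : #(B.image (· + 1)) = #B := card_image_of_injective _ (add_left_injective 1)
  have hdisj : Disjoint A (B.image (· + 1)) := by
    rw [Finset.disjoint_left]
    intro i hi hi'
    obtain ⟨j, hj, rfl⟩ := Finset.mem_image.1 hi'
    rw [hmemA] at hi; rw [hmemB] at hj
    exact hno j hj.1.1 (by omega) hi.2 hj.2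
  have hsub : A ∪ B.image (· + 1) ⊆ Finset.Icc 2 N := by
    intro i hi
    rw [Finset.mem_union, Finset.mem_image] at hi
    rw [Finset.mem_Icc]
    rcases hi with hi | ⟨j, hj, rfl⟩
    · rw [hmemA] at hi
      have : i ≠ 1 := by rintro rfl; exact G.irrefl hi.2
      omega
    · rw [hmemB] at hj
      have : j ≠ N := by rintro rfl; exact G.irrefl hj.2
      omega
  have hcard := card_le_card hsub
  rw [card_union_of_disjoint hdisj, hcB, Nat.card_Icc] at hcard
  rw [Nat.card_Icc] at h1 h2
  simp only [Nat.add_sub_cancel] at h1 h2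
  refine ⟨by omega, fun hle i hi hiN => ?_⟩
  have heq : A ∪ B.image (· + 1) = Finset.Icc 2 N := by
    refine Finset.eq_of_subset_of_card_le hsub ?_
    rw [card_union_of_disjoint hdisj, hcB, Nat.card_Icc]
    omega
  have hmem : i + 1 ∈ A ∪ B.image (· + 1) := by
    rw [heq, Finset.mem_Icc]; omega
  rw [Finset.mem_union, Finset.mem_image] at hmem
  rcases hmem with hm | ⟨j, hj, hji⟩
  · exact Or.inl ((hmemA _).1 hm).2
  · obtain rfl : j = i := by omega
    exact Or.inr ((hmemB _).1 hj).2

/-- Replacing two edges of a spanning path by a crossing pair gives a cycle. -/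
lemma isCycleList_of_crossing {G : SimpleGraph V} (p : ℕ → V) {N i : ℕ}
    (hinj : Set.InjOn p (Finset.Icc 1 N)) (hN : 3 ≤ N)
    (hadj : ∀ k, 1 ≤ k → k < N → G.Adj (p k) (p (k + 1)))
    (hi : 1 ≤ i) (hiN : i < N) (h1 : G.Adj (p 1) (p (i + 1))) (h2 : G.Adj (p N) (p i)) :
    IsCycleList G ((upList 1 i ++ (upList (i + 1) N).reverse).map p) := by
  refine isCycleList_map (a := 1) (b := i + 1) p ?_ ?_ ?_ ?_ h1.symm
  · intro a ha b hb hab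
    simp only [List.mem_append, List.mem_reverse, mem_upList] at ha hb
    exact hinj (by simp; omega) (by simp; omega) hab
  · refine List.nodup_append.2 ⟨nodup_upList _ _, List.nodup_reverse.2 (nodup_upList _ _), ?_⟩
    intro a ha b hb
    simp only [List.mem_reverse, mem_upList] at ha hb
    omega
  · simp only [List.length_append, List.length_reverse, length_upList]; omega
  · refine (isPathList_upList hi fun k hk hk' => hadj k hk (by omega)).append
      ((isPathList_upList (by omega) fun k hk hk' => hadj k (by omega) hk').reverse
        fun a b h => h.symm) h2.symm

lemma IsOTG.mono [Fintype V] {G H : SimpleGraph V} (hG : IsOTG G) (hGH : G ≤ H) : IsOTG H :=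
  fun u v huv hnadj => (hG u v huv fun h => hnadj (hGH h)).trans
    (add_le_add (degree_le_of_le hGH) (degree_le_of_le hGH))

/-- **Ore's theorem**. -/
theorem exists_isCycleSeq_of_isOTG [Fintype V] (h3 : 3 ≤ Fintype.card V) (G : SimpleGraph V)
    (hG : IsOTG G) : ∃ c, IsCycleSeq G (Fintype.card V) c := by
  induction G using WellFoundedGT.induction with
  | ind G ih =>
  by_cases htop : G = ⊤
  · subst htop
    have hl : IsCycleList (⊤ : SimpleGraph V) (univ : Finset V).toList := by
      have hne : (univ : Finset V).toList ≠ [] := by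
        intro h
        have := congrArg List.length h
        simp at this
        omega
      have hnd := (univ : Finset V).nodup_toList
      refine ⟨hnd, by simpa using h3, _, _,
        ⟨List.head?_eq_some_head hne, List.getLast?_eq_some_getLast hne, ?_⟩, ?_⟩
      · exact List.Pairwise.isChain (hnd.imp fun h => by simpa using h)
      · rw [top_adj, List.getLast_eq_getElem, List.head_eq_getElem]
        intro h
        have := (List.Nodup.getElem_inj_iff hnd).1 h
        simp at this
        omega
    obtain ⟨c, hc, -⟩ := hl.exists_isCycleSeq
    exact ⟨c, by simpa using hc⟩
  · obtain ⟨u, v, huv, hnadj⟩ : ∃ u v, u ≠ v ∧ ¬G.Adj u v := by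
      by_contra! h
      exact htop (by ext a b; simpa using ⟨fun h => h.ne, h a b⟩)
    have hlt : G < G ⊔ edge u v := by
      refine lt_of_le_of_ne le_sup_left fun h => hnadj ?_
      rw [h]; simp [edge_adj, huv]
    obtain ⟨c, hc⟩ := ih _ hlt (hG.mono le_sup_left)
    by_cases hall : ∀ i, G.Adj (c i) (c (i + 1))
    · exact ⟨c, h3, hall, hc.periodic, hc.inj⟩
    push Not at hall
    obtain ⟨i, hi⟩ := hall
    have hedge : ∀ j, ¬G.Adj (c j) (c (j + 1)) →
        (c j = u ∧ c (j + 1) = v) ∨ (c j = v ∧ c (j + 1) = u) := by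
      intro j hj
      have := hc.adj j
      rw [sup_adj, or_iff_right hj, edge_adj] at this
      tauto
    set n := Fintype.card V with hn
    set p : ℕ → V := fun j => c (i + j) with hp
    have hpn : p n = c i := hc.periodic i
    have hinj : Set.InjOn p (Finset.Icc 1 n) := by
      intro a ha b hb hab
      simp only [coe_Icc, Set.mem_Icc] at ha hb
      have := hc.inj' (i := i + a) (j := i + b) (by omega) (by omega) hab
      omega
    have hadj : ∀ k, 1 ≤ k → k < n → G.Adj (p k) (p (k + 1)) := by
      intro k hk hkn
      by_contra hcon
      have e1 := hedge i hi
      have e2 := hedge (i + k) hcon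
      have e3 : c (i + k) ≠ c i := fun h => by
        have := hc.inj' (i := i + k) (j := i) (by omega) (by omega) h
        omega
      have e4 : c (i + k + 1) ≠ c (i + 1) := fun h => by
        have := hc.inj' (i := i + k + 1) (j := i + 1) (by omega) (by omega) h
        omega
      have e5 : c (i + k) = c (i + 1) := by
        rcases e1 with e1 | e1 <;> rcases e2 with e2 | e2 <;> simp_all
      have e6 : c (i + k + 1) = c i := by
        rcases e1 with e1 | e1 <;> rcases e2 with e2 | e2 <;> simp_all
      have e7 := hc.inj' (i := i + k) (j := i + 1) (by omega) (by omega) e5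
      rw [e7, ← hc.periodic i] at e6
      have := hc.inj' (i := i + 1 + 1) (j := i + n) (by omega) (by omega) e6
      omega
    by_cases hcr : ∃ j, 1 ≤ j ∧ j < n ∧ G.Adj (p 1) (p (j + 1)) ∧ G.Adj (p n) (p j)
    · obtain ⟨j, h1, h2, h4, h5⟩ := hcr
      obtain ⟨c', hc', -⟩ := (isCycleList_of_crossing p hinj h3 hadj h1 h2 h4 h5).exists_isCycleSeq
      refine ⟨c', ?_⟩
      convert hc'
      simp only [List.length_map, List.length_append, List.length_reverse, length_upList]
      omega
    · push Not at hcr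
      have := (degree_add_degree_le_of_no_crossing G p n hinj hcr).1
      have hge := hG (p n) (p 1) (by rw [hpn]; exact (hc.adj i).ne) (by rwa [hpn])
      omega

lemma IsPathList.isCycleList_cons {G : SimpleGraph V} {a b w : V} {l : List V}
    (h : IsPathList G.Adj a b l) (hnd : l.Nodup) (hlen : 2 ≤ l.length) (hw : w ∉ l)
    (hwa : G.Adj w a) (hwb : G.Adj w b) : IsCycleList G (w :: l) where
  nodup := List.nodup_cons.2 ⟨hw, hnd⟩
  three_le := by simp; omega
  closed := ⟨w, b, (IsPathList.singleton _ w).append h hwa, hwb.symm⟩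

namespace IsCycleSeq

variable {G : SimpleGraph V} {M : ℕ} {c : ℕ → V}

lemma isPathList (h : IsCycleSeq G M c) {i j : ℕ} (hij : i ≤ j) :
    IsPathList (fun i j => G.Adj (c i) (c j)) i j (upList i j) :=
  isPathList_upList hij fun k _ _ => h.adj k

lemma isCycleList (h : IsCycleSeq G M c) (i : ℕ) :
    IsCycleList G ((upList i (i + M - 1)).map c) := by
  have h3 := h.three_le
  refine isCycleList_map (a := i) (b := i + M - 1) c ?_ (nodup_upList _ _) ?_
    (h.isPathList (by omega)) ?_
  · intro a ha b hb hab
    rw [mem_upList] at ha hb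
    exact h.inj' (by omega) (by omega) hab
  · rw [length_upList]; omega
  · have := h.adj (i + M - 1)
    rwa [show i + M - 1 + 1 = i + M by omega, h.periodic] at this

lemma exists_eq_of_le (h : IsCycleSeq G M c) (k s : ℕ) :
    ∃ k', s ≤ k' ∧ k' < s + M ∧ c k' = c k := by
  have h3 := h.three_le
  have hper : Function.Periodic c M := h.periodic
  refine ⟨s + (k + (M - 1) * s) % M, by omega, ?_, ?_⟩
  · have := Nat.mod_lt (k + (M - 1) * s) (show 0 < M by omega)
    omega
  · rw [← hper.map_mod_nat, ← hper.map_mod_nat k, Nat.add_mod_mod]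
    congr 1
    obtain ⟨M', rfl⟩ : ∃ M', M = M' + 1 := ⟨M - 1, by omega⟩
    rw [Nat.add_sub_cancel, show s + (k + M' * s) = k + (M' + 1) * s by ring,
      Nat.add_mul_mod_self_left]

lemma shift (h : IsCycleSeq G M c) (s : ℕ) : IsCycleSeq G M (fun i => c (s + i)) where
  three_le := h.three_le
  adj i := h.adj (s + i)
  periodic i := by rw [← add_assoc, h.periodic]
  inj i j hij hj := h.inj _ _ (by omega) (by omega)

end IsCycleSeq

/-- If a cycle misses exactly the vertices `w` and `y` of `G`, where `w` has two neighbours on it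
and `y` is outside the H-force set `X`, then `X` is independent of cardinality `n / 2`. -/
lemma card_eq_and_independent_of_isCycleSeq [Fintype V] {G : SimpleGraph V} {m : ℕ} (hm : 3 ≤ m)
    (hcard : Fintype.card V = 2 * m)
    (hdeg : ∀ u v, u ≠ v → ¬G.Adj u v → G.degree u + G.degree v = 2 * m)
    {X : Finset V} (hXm : #X ≤ m)
    (hX : ∀ l, IsCycleList G l → (∀ x ∈ X, x ∈ l) → ∀ v, v ∈ l)
    {c : ℕ → V} (hc : IsCycleSeq G (2 * m - 2) c) {w y : V} (hcw : ∀ i, c i ≠ w)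
    (hcy : ∀ i, c i ≠ y) (hwy : w ≠ y) (hy : y ∉ X) {i j : ℕ} (hij : i < j)
    (hji : j < i + (2 * m - 2)) (hwi : G.Adj w (c i)) (hwj : G.Adj w (c j)) :
    #X = m ∧ ∀ a ∈ X, ∀ b ∈ X, ¬G.Adj a b := by
  set M := 2 * m - 2 with hM
  have hinjM : ∀ s, Set.InjOn c (Finset.Ico s (s + M)) := by
    intro s a ha b hb hab
    simp only [coe_Ico, Set.mem_Ico] at ha hb
    exact hc.inj' (by omega) (by omega) hab
  have hrange : Set.InjOn c (Finset.range M) := by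
    have := hinjM 0
    rwa [zero_add, ← Finset.range_eq_Ico] at this
  have hcover : ∀ v, v ≠ w → v ≠ y → ∃ k, c k = v := by
    have huniv : insert w (insert y ((Finset.range M).image c)) = univ := by
      refine Finset.eq_univ_of_card _ ?_
      rw [card_insert_of_notMem, card_insert_of_notMem, card_image_of_injOn hrange, card_range]
      · omega
      · simpa using fun i _ => hcy i
      · simpa [hwy] using fun i _ => hcw i
    intro v hvw hvy
    have := Finset.mem_univ v
    rw [← huniv] at this
    simp only [Finset.mem_insert, hvw, hvy, Finset.mem_image, false_or] at this
    obtain ⟨k, -, hk⟩ := this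
    exact ⟨k, hk⟩
  have hcover' : ∀ s v, v ≠ w → v ≠ y → ∃ k, s ≤ k ∧ k < s + M ∧ c k = v := by
    intro s v hvw hvy
    obtain ⟨k, rfl⟩ := hcover v hvw hvy
    exact hc.exists_eq_of_le k s
  have hwnot : ∀ L : List ℕ, w ∉ L.map c := by
    intro L h
    obtain ⟨k, -, hk⟩ := List.mem_map.1 h
    exact hcw k hk
  have hynot : ∀ L : List ℕ, y ∉ L.map c := by
    intro L h
    obtain ⟨k, -, hk⟩ := List.mem_map.1 h
    exact hcy k hk
  have hno : ∀ L : List ℕ, IsCycleList G (w :: L.map c) → ∀ s,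
      ∃ k, s ≤ k ∧ k < s + M ∧ k ∉ L ∧ c k ∈ X := by
    intro L hL s
    by_contra! hcon
    have := hX _ hL (fun x hx => ?_) y
    · rcases List.mem_cons.1 this with h | h
      · exact hwy h.symm
      · exact hynot L h
    · by_cases hxw : x = w
      · simp [hxw]
      · obtain ⟨k, h1, h2, rfl⟩ := hcover' s x hxw (by rintro rfl; exact hy hx)
        refine List.mem_cons_of_mem _ (List.mem_map_of_mem ?_)
        by_contra hk
        exact hcon k h1 h2 hk hx
  have hsucc : ∀ i, G.Adj w (c i) → ¬G.Adj w (c (i + 1)) := by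
    intro i h1 h2
    have hC : IsCycleList G (w :: (upList (i + 1) (i + M)).map c) := by
      refine ((hc.isPathList (by omega)).map c).isCycleList_cons ?_ ?_ (hwnot _) h2
        (by rwa [hc.periodic])
      on_goal 2 => rw [List.length_map, length_upList]; omega
      refine List.Nodup.map_on ?_ (nodup_upList _ _)
      intro a ha b hb
      rw [mem_upList] at ha hb
      exact hc.inj' (by omega) (by omega)
    obtain ⟨k, hk1, hk2, hk3, -⟩ := hno _ hC (i + 1)
    exact hk3 (mem_upList.2 (by omega))
  have hsucc2 : ∀ i j, i < j → j < i + M → G.Adj w (c i) → G.Adj w (c j) →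
      ¬G.Adj (c (i + 1)) (c (j + 1)) := by
    intro i j hij hji h1 h2 h3
    have hC : IsCycleList G
        (w :: ((upList (i + 1) j).reverse ++ upList (j + 1) (i + M)).map c) := by
      refine ((((hc.isPathList (by omega)).reverse (fun a b h => h.symm)).append
          (hc.isPathList (by omega)) h3).map c).isCycleList_cons ?_ ?_ (hwnot _) h2
        (by rwa [hc.periodic])
      on_goal 2 =>
        simp only [List.length_map, List.length_append, List.length_reverse, length_upList]
        omega
      refine List.Nodup.map_on ?_ ?_
      · intro a ha b hb
        simp only [List.mem_append, List.mem_reverse, mem_upList] at ha hb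
        exact hc.inj' (by omega) (by omega)
      · refine List.nodup_append.2 ⟨List.nodup_reverse.2 (nodup_upList _ _), nodup_upList _ _, ?_⟩
        intro a ha b hb
        simp only [List.mem_reverse, mem_upList] at ha hb
        omega
    obtain ⟨k, hk1, hk2, hk3, -⟩ := hno _ hC (i + 1)
    simp only [List.mem_append, List.mem_reverse, mem_upList] at hk3
    omega
  have hdw : G.degree w = m := by
    have e1 := hdeg w (c (i + 1)) (hcw _).symm (hsucc i hwi)
    have e2 := hdeg w (c (j + 1)) (hcw _).symm (hsucc j hwj)
    have e3 := hdeg (c (i + 1)) (c (j + 1)) (hc.inj _ _ (by omega) (by omega))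
      (hsucc2 i j hij hji hwi hwj)
    omega
  set T : Finset ℕ := {k ∈ Finset.range M | G.Adj w (c k)} with hT
  set T' : Finset ℕ := {k ∈ Finset.range M | G.Adj w (c (k + 1))} with hT'
  have hTle : m ≤ #T + 1 := by
    rw [← hdw, ← card_neighborFinset_eq_degree]
    calc #(G.neighborFinset w) ≤ #(insert y (T.image c)) := by
          refine card_le_card fun v hv => ?_
          rw [mem_neighborFinset] at hv
          rw [Finset.mem_insert]
          by_cases hvy : v = y
          · exact Or.inl hvy
          · obtain ⟨k, -, hk, rfl⟩ := hcover' 0 v hv.ne' hvy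
            refine Or.inr (Finset.mem_image_of_mem _ ?_)
            rw [hT, Finset.mem_filter, Finset.mem_range]
            exact ⟨by omega, hv⟩
      _ ≤ #T + 1 := (card_insert_le _ _).trans (by gcongr; exact card_image_le)
  have hTT' : #T' = #T := by
    rw [hT, hT', card_filter, card_filter]
    have e1 := Finset.sum_range_succ (fun k => if G.Adj w (c k) then 1 else 0) M
    have e2 := Finset.sum_range_succ' (fun k => if G.Adj w (c k) then 1 else 0) M
    have e3 : c M = c 0 := by simpa using hc.periodic 0
    rw [e3] at e1
    omega
  have hdisj : Disjoint T T' := by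
    rw [Finset.disjoint_left]
    intro k hk hk'
    exact hsucc k (Finset.mem_filter.1 hk).2 (Finset.mem_filter.1 hk').2
  have hsub : T ∪ T' ⊆ Finset.range M :=
    Finset.union_subset (Finset.filter_subset _ _) (Finset.filter_subset _ _)
  have hle := card_le_card hsub
  rw [card_union_of_disjoint hdisj, card_range] at hle
  have hunion : T ∪ T' = Finset.range M :=
    Finset.eq_of_subset_of_card_le hsub (by rw [card_union_of_disjoint hdisj, card_range]; omega)
  have hper : Function.Periodic c M := hc.periodic
  have halt : ∀ k, G.Adj w (c k) ∨ G.Adj w (c (k + 1)) := by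
    intro k
    have h1 : k % M ∈ T ∪ T' := by
      rw [hunion, Finset.mem_range]; exact Nat.mod_lt _ (by omega)
    have h2 : c (k % M) = c k := hper.map_mod_nat k
    have h3 : c (k % M + 1) = c (k + 1) := by
      rw [← hper.map_mod_nat, Nat.mod_add_mod, hper.map_mod_nat]
    rw [Finset.mem_union, hT, hT', Finset.mem_filter, Finset.mem_filter, h2, h3] at h1
    tauto
  have hpred : ∀ k, ¬G.Adj w (c k) → G.Adj w (c (k + M - 1)) := by
    intro k hk
    have := halt (k + M - 1)
    rw [show k + M - 1 + 1 = k + M by omega, hc.periodic] at this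
    tauto
  have hmemX : ∀ k, ¬G.Adj w (c k) → c k ∈ X := by
    intro k hk
    have hC : IsCycleList G (w :: (upList (k + 1) (k + M - 1)).map c) := by
      refine ((hc.isPathList (by omega)).map c).isCycleList_cons ?_ ?_ (hwnot _)
        ((halt k).resolve_left hk) (hpred k hk)
      on_goal 2 => rw [List.length_map, length_upList]; omega
      refine List.Nodup.map_on ?_ (nodup_upList _ _)
      intro a ha b hb
      rw [mem_upList] at ha hb
      exact hc.inj' (by omega) (by omega)
    obtain ⟨k', hk1, hk2, hk3, hk4⟩ := hno _ hC k
    rw [mem_upList] at hk3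
    obtain rfl : k' = k := by omega
    exact hk4
  have hwX : w ∈ X := by
    by_contra hwX
    refine hynot _ (hX _ (hc.isCycleList 0) (fun x hx => ?_) y)
    obtain ⟨k, h1, h2, rfl⟩ := hcover' 0 x (by rintro rfl; exact hwX hx)
      (by rintro rfl; exact hy hx)
    exact List.mem_map_of_mem (mem_upList.2 (by omega))
  set U : Finset ℕ := {k ∈ Finset.range M | ¬G.Adj w (c k)} with hU
  have hUT : #T + #U = M := by
    rw [hT, hU, card_filter_add_card_filter_not, card_range]
  have hwU : w ∉ U.image c := by simpa using fun k _ => hcw k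
  have hcardU : #(insert w (U.image c)) = m := by
    rw [card_insert_of_notMem hwU, card_image_of_injOn (hrange.mono (by
      exact_mod_cast Finset.filter_subset _ _))]
    omega
  have hXeq : insert w (U.image c) = X := by
    refine Finset.eq_of_subset_of_card_le ?_ (by omega)
    rw [Finset.insert_subset_iff, Finset.image_subset_iff]
    exact ⟨hwX, fun k hk => hmemX k (Finset.mem_filter.1 hk).2⟩
  have hlt : ∀ k l, k < l → l < M → ¬G.Adj w (c k) → ¬G.Adj w (c l) → ¬G.Adj (c k) (c l) := by
    intro k l hkl hl hk hl'
    have := hsucc2 (k + M - 1) (l + M - 1) (by omega) (by omega) (hpred k hk) (hpred l hl')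
    rwa [show k + M - 1 + 1 = k + M by omega, show l + M - 1 + 1 = l + M by omega,
      hc.periodic, hc.periodic] at this
  refine ⟨by rw [← hXeq, hcardU], ?_⟩
  rw [← hXeq]
  simp only [hU, Finset.mem_insert, Finset.mem_image, Finset.mem_filter, Finset.mem_range]
  rintro a (rfl | ⟨k, ⟨hkM, hk⟩, rfl⟩) b (rfl | ⟨l, ⟨hlM, hl⟩, rfl⟩)
  · exact G.irrefl
  · exact hl
  · exact fun h => hk h.symm
  · rcases lt_trichotomy k l with h | rfl | h
    · exact hlt k l h hlM hk hl
    · exact G.irrefl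
    · exact fun h' => hlt l k h hkM hl hk h'.symm

lemma adj_of_degree_le [Fintype V] {G : SimpleGraph V} {v w : V} (S : Finset V)
    (hsub : G.neighborFinset v ⊆ S) (hS : #S ≤ G.degree v) (hw : w ∈ S) : G.Adj v w := by
  rw [← card_neighborFinset_eq_degree] at hS
  rwa [← mem_neighborFinset, Finset.eq_of_subset_of_card_le hsub hS]

/-- If removing the vertices `x 0` and `x k` of a Hamiltonian cycle `x` separates the two remaining
arcs, then no H-force set has at most `n / 2` vertices. -/
lemma false_of_isCycleSeq_of_separated [Fintype V] {G : SimpleGraph V} {m : ℕ} (hm : 3 ≤ m)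
    (hcard : Fintype.card V = 2 * m)
    (hdeg : ∀ u v, u ≠ v → ¬G.Adj u v → G.degree u + G.degree v = 2 * m)
    {X : Finset V} (hXm : #X ≤ m)
    (hX : ∀ l, IsCycleList G l → (∀ x ∈ X, x ∈ l) → ∀ v, v ∈ l)
    {x : ℕ → V} (hx : IsCycleSeq G (2 * m) x) (hcover : ∀ v, ∃ k < 2 * m, x k = v) {k : ℕ}
    (hk : 2 ≤ k) (hkn : k ≤ 2 * m - 2)
    (hsep : ∀ a b, 1 ≤ a → a < k → k < b → b < 2 * m → ¬G.Adj (x a) (x b)) : False := by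
  have hx0 : x (2 * m) = x 0 := by simpa using hx.periodic 0
  have hinj0 : Set.InjOn x (Finset.Icc 0 k) := by
    intro a ha b hb hab
    simp only [coe_Icc, Set.mem_Icc] at ha hb
    exact hx.inj' (by omega) (by omega) hab
  have hinjk : Set.InjOn x (Finset.Icc k (2 * m)) := by
    intro a ha b hb hab
    simp only [coe_Icc, Set.mem_Icc] at ha hb
    exact hx.inj' (by omega) (by omega) hab
  have hsubA : ∀ a, 1 ≤ a → a < k →
      G.neighborFinset (x a) ⊆ ((Finset.Icc 0 k).erase a).image x := by
    intro a ha hak v hv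
    rw [mem_neighborFinset] at hv
    obtain ⟨t, ht, rfl⟩ := hcover v
    refine Finset.mem_image_of_mem _ (Finset.mem_erase.2 ⟨?_, Finset.mem_Icc.2 ⟨by omega, ?_⟩⟩)
    · rintro rfl; exact G.irrefl hv
    · by_contra htk
      exact hsep a t ha hak (by omega) ht hv
  have hsubB : ∀ b, k < b → b < 2 * m →
      G.neighborFinset (x b) ⊆ ((Finset.Icc k (2 * m)).erase b).image x := by
    intro b hb hbn v hv
    rw [mem_neighborFinset] at hv
    obtain ⟨t, ht, rfl⟩ := hcover v
    by_cases ht0 : t = 0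
    · subst ht0
      rw [← hx0]
      exact Finset.mem_image_of_mem _ (Finset.mem_erase.2 ⟨by omega, Finset.mem_Icc.2 (by omega)⟩)
    refine Finset.mem_image_of_mem _ (Finset.mem_erase.2 ⟨?_, Finset.mem_Icc.2 ⟨?_, by omega⟩⟩)
    · rintro rfl; exact G.irrefl hv
    · by_contra htk
      exact hsep t b (by omega) (by omega) hb hbn hv.symm
  have hcardA : ∀ a, a < k → #(((Finset.Icc 0 k).erase a).image x) = k := by
    intro a hak
    rw [card_image_of_injOn (hinj0.mono (by exact_mod_cast Finset.erase_subset _ _)),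
      card_erase_of_mem (Finset.mem_Icc.2 (by omega)), Nat.card_Icc]
    omega
  have hcardB : ∀ b, k < b → b < 2 * m →
      #(((Finset.Icc k (2 * m)).erase b).image x) = 2 * m - k := by
    intro b hb hbn
    rw [card_image_of_injOn (hinjk.mono (by exact_mod_cast Finset.erase_subset _ _)),
      card_erase_of_mem (Finset.mem_Icc.2 (by omega)), Nat.card_Icc]
    omega
  have hdA : ∀ a, 1 ≤ a → a < k → G.degree (x a) ≤ k := by
    intro a ha hak
    rw [← card_neighborFinset_eq_degree, ← hcardA a hak]
    exact card_le_card (hsubA a ha hak)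
  have hdB : ∀ b, k < b → b < 2 * m → G.degree (x b) ≤ 2 * m - k := by
    intro b hb hbn
    rw [← card_neighborFinset_eq_degree, ← hcardB b hb hbn]
    exact card_le_card (hsubB b hb hbn)
  have hsum : ∀ a b, 1 ≤ a → a < k → k < b → b < 2 * m →
      G.degree (x a) + G.degree (x b) = 2 * m := fun a b h1 h2 h3 h4 =>
    hdeg _ _ (hx.inj a b (by omega) (by omega)) (hsep a b h1 h2 h3 h4)
  have hA : ∀ a t, 1 ≤ a → a < k → t ≤ k → t ≠ a → G.Adj (x a) (x t) := by
    intro a t h1 h2 h3 h4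
    refine adj_of_degree_le _ (hsubA a h1 h2) ?_
      (Finset.mem_image_of_mem _ (Finset.mem_erase.2 ⟨h4, Finset.mem_Icc.2 (by omega)⟩))
    have := hsum a (2 * m - 1) h1 h2 (by omega) (by omega)
    have := hdB (2 * m - 1) (by omega) (by omega)
    rw [hcardA a h2]; omega
  have hB : ∀ b t, k < b → b < 2 * m → k ≤ t → t ≤ 2 * m → t ≠ b → G.Adj (x b) (x t) := by
    intro b t h1 h2 h3 h4 h5
    refine adj_of_degree_le _ (hsubB b h1 h2) ?_
      (Finset.mem_image_of_mem _ (Finset.mem_erase.2 ⟨h5, Finset.mem_Icc.2 (by omega)⟩))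
    have := hsum 1 b (by omega) (by omega) h1 h2
    have := hdA 1 (by omega) (by omega)
    rw [hcardB b h1 h2]; omega
  have h0k : G.Adj (x 0) (x k) := by
    by_contra hcon
    have hsum0 := hdeg _ _ (hx.inj 0 k (by omega) (by omega)) hcon
    have hinj : Set.InjOn x ((Finset.Icc 1 (2 * m - 1)).erase k) := by
      intro a ha b hb hab
      simp only [coe_erase, coe_Icc, Set.mem_sdiff, Set.mem_Icc] at ha hb
      exact hx.inj' (by omega) (by omega) hab
    have hc : #(((Finset.Icc 1 (2 * m - 1)).erase k).image x) = 2 * m - 2 := by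
      rw [card_image_of_injOn hinj, card_erase_of_mem (Finset.mem_Icc.2 (by omega)), Nat.card_Icc]
      omega
    have h1 : 2 * m - 2 ≤ G.degree (x 0) := by
      rw [← hc, ← card_neighborFinset_eq_degree]
      refine card_le_card fun v hv => ?_
      obtain ⟨t, ht, rfl⟩ := Finset.mem_image.1 hv
      rw [Finset.mem_erase, Finset.mem_Icc] at ht
      rw [mem_neighborFinset, adj_comm]
      rcases lt_or_gt_of_ne ht.1 with h | h
      · exact hA t 0 (by omega) h (by omega) (by omega)
      · rw [← hx0]; exact hB t _ h (by omega) (by omega) le_rfl (by omega)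
    have h2 : 2 * m - 2 ≤ G.degree (x k) := by
      rw [← hc, ← card_neighborFinset_eq_degree]
      refine card_le_card fun v hv => ?_
      obtain ⟨t, ht, rfl⟩ := Finset.mem_image.1 hv
      rw [Finset.mem_erase, Finset.mem_Icc] at ht
      rw [mem_neighborFinset, adj_comm]
      rcases lt_or_gt_of_ne ht.1 with h | h
      · exact hA t k (by omega) h le_rfl ht.1.symm
      · exact hB t k h (by omega) le_rfl (by omega) ht.1.symm
    omega
  have hskip : ∀ j, x (j + 1) ∉ X → ¬G.Adj (x j) (x (j + 2)) := by
    intro j hj hadj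
    have hC : IsCycleList G ((upList (j + 2) (j + 2 * m)).map x) := by
      refine isCycleList_map (a := j + 2) (b := j + 2 * m) x ?_ (nodup_upList _ _) ?_
        (hx.isPathList (by omega)) (by rwa [hx.periodic])
      · intro a ha b hb hab
        rw [mem_upList] at ha hb
        exact hx.inj' (by omega) (by omega) hab
      · rw [length_upList]; omega
    obtain ⟨t, ht, ht'⟩ := List.mem_map.1 (hX _ hC (fun v hv => by
      obtain ⟨s, -, rfl⟩ := hcover v
      obtain ⟨t, ht1, ht2, ht3⟩ := hx.exists_eq_of_le s (j + 1)
      rw [← ht3] at hv ⊢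
      refine List.mem_map_of_mem (mem_upList.2 ⟨?_, by omega⟩)
      by_contra h
      obtain rfl : t = j + 1 := by omega
      exact hj hv) (x (j + 1)))
    rw [mem_upList] at ht
    have := hx.inj' (by omega) (by omega) ht'
    omega
  obtain ⟨v, hv⟩ : ∃ v, v ∉ insert (x 0) (insert (x k) X) := by
    by_contra! hcon
    have h1 := card_insert_le (x 0) (insert (x k) X)
    have h2 := card_insert_le (x k) X
    rw [Finset.eq_univ_of_forall hcon, card_univ] at h1
    omega
  simp only [Finset.mem_insert, not_or] at hv
  obtain ⟨hv0, hvk, hvX⟩ := hv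
  obtain ⟨t, ht, rfl⟩ := hcover v
  have ht0 : t ≠ 0 := by rintro rfl; exact hv0 rfl
  have htk : t ≠ k := by rintro rfl; exact hvk rfl
  obtain ⟨j, rfl⟩ : ∃ j, t = j + 1 := ⟨t - 1, by omega⟩
  refine hskip j hvX ?_
  rcases lt_or_gt_of_ne htk with h | h
  · by_cases hj : j = 0
    · subst hj
      by_cases hk2 : k = 2
      · subst hk2; exact h0k
      · exact (hA 2 0 (by omega) (by omega) (by omega) (by omega)).symm
    · exact hA j (j + 2) (by omega) (by omega) (by omega) (by omega)
  · by_cases hj : j + 2 = 2 * m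
    · rw [hj, hx0]
      by_cases hjk : j = k
      · rw [hjk]; exact h0k.symm
      · rw [← hx0]; exact hB j _ (by omega) (by omega) (by omega) le_rfl (by omega)
    · exact (hB (j + 2) j (by omega) (by omega) (by omega) (by omega) (by omega)).symm

lemma card_eq_and_independent [Fintype V] {G : SimpleGraph V} {m : ℕ} (hm : 3 ≤ m)
    (hcard : Fintype.card V = 2 * m)
    (hdeg : ∀ u v, u ≠ v → ¬G.Adj u v → G.degree u + G.degree v = 2 * m)
    {X : Finset V} (hXm : #X ≤ m)
    (hX : ∀ l, IsCycleList G l → (∀ x ∈ X, x ∈ l) → ∀ v, v ∈ l) :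
    #X = m ∧ ∀ a ∈ X, ∀ b ∈ X, ¬G.Adj a b := by
  obtain ⟨y, hy⟩ : ∃ y, y ∉ X := by
    by_contra! hcon
    rw [Finset.eq_univ_of_forall hcon, card_univ] at hXm
    omega
  obtain ⟨x₀, hx₀⟩ := exists_isCycleSeq_of_isOTG (by omega) G fun u v huv hnadj => by
    rw [hcard, hdeg u v huv hnadj]
  rw [hcard] at hx₀
  have hcov₀ : ∀ v, ∃ k, x₀ k = v := by
    have huniv : (Finset.range (2 * m)).image x₀ = univ := by
      refine Finset.eq_univ_of_card _ ?_
      rw [card_image_of_injOn, card_range, hcard]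
      intro a ha b hb hab
      simp only [coe_range, Set.mem_Iio] at ha hb
      exact hx₀.inj' (by omega) (by omega) hab
    intro v
    obtain ⟨k, -, hk⟩ := Finset.mem_image.1 (huniv ▸ Finset.mem_univ v)
    exact ⟨k, hk⟩
  obtain ⟨s, hs⟩ := hcov₀ y
  obtain ⟨x, hx, hx0, hcov⟩ : ∃ x, IsCycleSeq G (2 * m) x ∧ x 0 = y ∧ ∀ v, ∃ k, x k = v :=
    ⟨_, hx₀.shift s, hs, fun v => by
      obtain ⟨k, rfl⟩ := hcov₀ v
      obtain ⟨k', h1, -, h3⟩ := hx₀.exists_eq_of_le k s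
      exact ⟨k' - s, by simpa [Nat.add_sub_cancel' h1] using h3⟩⟩
  have hcover : ∀ v, ∃ k < 2 * m, x k = v := by
    intro v
    obtain ⟨k, rfl⟩ := hcov v
    obtain ⟨k', -, h2, h3⟩ := hx.exists_eq_of_le k 0
    exact ⟨k', by omega, h3⟩
  have hinj : Set.InjOn x (Finset.Icc 1 (2 * m - 1)) := by
    intro a ha b hb hab
    simp only [coe_Icc, Set.mem_Icc] at ha hb
    exact hx.inj' (by omega) (by omega) hab
  have hno : ∀ L : List ℕ, IsCycleList G (L.map x) → (∀ k ∈ L, k ≠ 0 ∧ k < 2 * m) →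
      ∃ k, 1 ≤ k ∧ k < 2 * m ∧ k ∉ L ∧ x k ∈ X := by
    intro L hL hL0
    by_contra! hcon
    have hmem := hX _ hL (fun v hv => by
      obtain ⟨k, hk, rfl⟩ := hcover v
      refine List.mem_map_of_mem ?_
      by_contra hkL
      refine hcon k ?_ hk hkL hv
      by_contra hk0
      obtain rfl : k = 0 := by omega
      exact hy (hx0 ▸ hv)) y
    obtain ⟨k, hk, hky⟩ := List.mem_map.1 hmem
    obtain ⟨h1, h2⟩ := hL0 k hk
    exact h1 (hx.inj' (by omega) (by omega) (hky.trans hx0.symm))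
  have hcross : ∀ i, 1 ≤ i → i < 2 * m - 1 → G.Adj (x 1) (x (i + 1)) →
      ¬G.Adj (x (2 * m - 1)) (x i) := by
    intro i hi hin h1 h2
    obtain ⟨k, hk1, hk2, hk3, -⟩ := hno _
      (isCycleList_of_crossing x hinj (by omega) (fun k _ _ => hx.adj k) hi hin h1 h2)
      (fun k hk => by
        simp only [List.mem_append, List.mem_reverse, mem_upList] at hk; omega)
    simp only [List.mem_append, List.mem_reverse, mem_upList] at hk3
    omega
  have hadj1 : G.Adj (x 1) (x 2) := hx.adj 1
  have hadjl : G.Adj (x (2 * m - 1)) (x (2 * m - 2)) := by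
    have := hx.adj (2 * m - 2)
    rw [show 2 * m - 2 + 1 = 2 * m - 1 by omega] at this
    exact this.symm
  have hn1l : ¬G.Adj (x 1) (x (2 * m - 1)) := by
    have := fun h => hcross (2 * m - 2) (by omega) (by omega) h hadjl
    rwa [show 2 * m - 2 + 1 = 2 * m - 1 by omega] at this
  have hor : ∀ i, 1 ≤ i → i < 2 * m - 1 →
      G.Adj (x 1) (x (i + 1)) ∨ G.Adj (x (2 * m - 1)) (x i) := by
    refine (degree_add_degree_le_of_no_crossing G x (2 * m - 1) hinj hcross).2 ?_
    rw [hdeg _ _ (hx.inj _ _ (by omega) (by omega)) hn1l]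
    omega
  by_cases hgap : ∃ i, 2 ≤ i ∧ i < 2 * m - 2 ∧ ¬G.Adj (x 1) (x (i + 1)) ∧ G.Adj (x 1) (x (i + 2))
  · obtain ⟨i, hi2, hin, hni, hai⟩ := hgap
    have hil := (hor i (by omega) (by omega)).resolve_left hni
    set L := upList 1 i ++ (upList (i + 2) (2 * m - 1)).reverse with hLdef
    have hmemL : ∀ k, k ∈ L ↔ 1 ≤ k ∧ k ≤ 2 * m - 1 ∧ k ≠ i + 1 := by
      intro k
      simp only [hLdef, List.mem_append, List.mem_reverse, mem_upList]
      omega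
    have hlen : L.length = 2 * m - 2 := by
      simp only [hLdef, List.length_append, List.length_reverse, length_upList]; omega
    have hL : IsCycleList G (L.map x) := by
      refine isCycleList_map (a := 1) (b := i + 2) x ?_ ?_ ?_ ?_ hai.symm
      · intro a ha b hb hab
        rw [hmemL] at ha hb
        exact hx.inj' (by omega) (by omega) hab
      · refine List.nodup_append.2
          ⟨nodup_upList _ _, List.nodup_reverse.2 (nodup_upList _ _), ?_⟩
        intro a ha b hb
        simp only [List.mem_reverse, mem_upList] at ha hb
        omega
      · omega
      · exact (hx.isPathList (by omega)).append
          ((hx.isPathList (by omega)).reverse fun a b h => h.symm) hil.symm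
    obtain ⟨c, hc, hcL⟩ := hL.exists_isCycleSeq
    rw [List.length_map, hlen] at hc hcL
    have hcx : ∀ k, k < 2 * m → k ∉ L → ∀ j, c j ≠ x k := by
      intro k hk hkL j hj
      obtain ⟨j', -, h2, h3⟩ := hc.exists_eq_of_le j 0
      obtain ⟨t, ht, ht'⟩ := List.mem_map.1 ((hcL (x k)).2 ⟨j', by omega, h3.trans hj⟩)
      have ht2 := (hmemL t).1 ht
      obtain rfl := hx.inj' (by omega) (by omega) ht'
      exact hkL ht
    obtain ⟨a, ha, hax⟩ := (hcL (x i)).1 (List.mem_map_of_mem ((hmemL i).2 (by omega)))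
    obtain ⟨b, hb, hbx⟩ := (hcL (x (i + 2))).1 (List.mem_map_of_mem ((hmemL (i + 2)).2 (by omega)))
    have hwa : G.Adj (x (i + 1)) (c a) := by rw [hax]; exact (hx.adj i).symm
    have hwb : G.Adj (x (i + 1)) (c b) := by rw [hbx]; exact hx.adj (i + 1)
    have hab : a ≠ b := by
      rintro rfl
      have := hx.inj' (by omega) (by omega) (hax.symm.trans hbx)
      omega
    have hcw := hcx (i + 1) (by omega) (by rw [hmemL]; omega)
    have hcy : ∀ j, c j ≠ y := by
      rw [← hx0]; exact hcx 0 (by omega) (by rw [hmemL]; omega)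
    have hwy : x (i + 1) ≠ y := by
      rw [← hx0]; exact (hx.inj _ _ (by omega) (by omega)).symm
    rcases lt_or_gt_of_ne hab with h | h
    · exact card_eq_and_independent_of_isCycleSeq hm hcard hdeg hXm hX hc hcw hcy hwy hy h
        (by omega) hwa hwb
    · exact card_eq_and_independent_of_isCycleSeq hm hcard hdeg hXm hX hc hcw hcy hwy hy h
        (by omega) hwb hwa
  · push Not at hgap
    exfalso
    have hdown : ∀ i j, 2 ≤ i → i ≤ j → j < 2 * m → G.Adj (x 1) (x j) → G.Adj (x 1) (x i) := by
      intro i j hi hij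
      induction j, hij using Nat.le_induction with
      | base => exact fun _ h => h
      | succ j hij ih =>
        intro hj h
        refine ih (by omega) ?_
        by_cases hj2 : j = 2
        · rwa [hj2]
        by_contra hcon
        by_cases hjl : j + 1 = 2 * m - 1
        · rw [hjl] at h; exact hn1l h
        refine hgap (j - 1) (by omega) (by omega) ?_ ?_
        · rwa [show j - 1 + 1 = j by omega]
        · rwa [show j - 1 + 2 = j + 1 by omega]
    set k := Nat.findGreatest (fun j => G.Adj (x 1) (x j)) (2 * m - 1) with hk
    have hk2 : 2 ≤ k := Nat.le_findGreatest (by omega) hadj1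
    have hkadj : G.Adj (x 1) (x k) :=
      Nat.findGreatest_spec (P := fun j => G.Adj (x 1) (x j)) (m := 2) (by omega) hadj1
    have hkl : k ≤ 2 * m - 1 := Nat.findGreatest_le _
    have hkl' : k ≠ 2 * m - 1 := fun h => hn1l (h ▸ hkadj)
    have h1adj : ∀ j, 2 ≤ j → j ≤ k → G.Adj (x 1) (x j) := fun j h1 h2 =>
      hdown j k h1 h2 (by omega) hkadj
    have hladj : ∀ j, k ≤ j → j < 2 * m - 1 → G.Adj (x (2 * m - 1)) (x j) := by
      intro j h1 h2
      refine (hor j (by omega) h2).resolve_left fun h => ?_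
      have := Nat.le_findGreatest (P := fun j => G.Adj (x 1) (x j)) (n := 2 * m - 1)
        (by omega) h
      omega
    refine false_of_isCycleSeq_of_separated hm hcard hdeg hXm hX hx hcover hk2 (by omega) ?_
    intro a b ha hak hkb hb hab
    have hC : IsCycleList G
        ((upList 1 a ++ upList b (2 * m - 1) ++ (upList (a + 1) (b - 1)).reverse).map x) := by
      refine isCycleList_map (a := 1) (b := a + 1) x ?_ ?_ ?_ ?_
        (h1adj (a + 1) (by omega) (by omega)).symm
      · intro i hi j hj hij
        simp only [List.mem_append, List.mem_reverse, mem_upList] at hi hj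
        exact hx.inj' (by omega) (by omega) hij
      · refine List.nodup_append.2 ⟨List.nodup_append.2 ⟨nodup_upList _ _, nodup_upList _ _, ?_⟩,
          List.nodup_reverse.2 (nodup_upList _ _), ?_⟩ <;>
        · intro i hi j hj
          simp only [List.mem_append, List.mem_reverse, mem_upList] at hi hj
          omega
      · simp only [List.length_append, List.length_reverse, length_upList]; omega
      · exact ((hx.isPathList (by omega)).append (hx.isPathList (by omega)) hab).append
          ((hx.isPathList (by omega)).reverse fun a b h => h.symm)
          (hladj (b - 1) (by omega) (by omega))
    obtain ⟨j, hj1, hj2, hj3, -⟩ := hno _ hC (fun j hj => by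
      simp only [List.mem_append, List.mem_reverse, mem_upList] at hj; omega)
    simp only [List.mem_append, List.mem_reverse, mem_upList] at hj3
    omega

lemma adj_of_independent [Fintype V] {G : SimpleGraph V} {m : ℕ} (hm : 2 ≤ m)
    (hcard : Fintype.card V = 2 * m)
    (hdeg : ∀ u v, u ≠ v → ¬G.Adj u v → G.degree u + G.degree v = 2 * m)
    {X : Finset V} (hXm : #X = m) (hind : ∀ a ∈ X, ∀ b ∈ X, ¬G.Adj a b) :
    (∀ a ∈ X, ∀ b ∉ X, G.Adj a b) ∧
      ((∀ a ∉ X, ∀ b ∉ X, a ≠ b → G.Adj a b) ∨ ∀ a ∉ X, ∀ b ∉ X, ¬G.Adj a b) := by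
  have hXc : #Xᶜ = m := by rw [card_compl]; omega
  have hsub : ∀ a ∈ X, G.neighborFinset a ⊆ Xᶜ := by
    intro a ha b hb
    rw [mem_neighborFinset] at hb
    exact Finset.mem_compl.2 fun h => hind a ha b h hb
  have hle : ∀ a ∈ X, G.degree a ≤ m := by
    intro a ha
    rw [← card_neighborFinset_eq_degree, ← hXc]
    exact card_le_card (hsub a ha)
  have hadj : ∀ a ∈ X, ∀ b ∉ X, G.Adj a b := by
    intro a ha b hb
    obtain ⟨a', ha', hne⟩ := Finset.exists_mem_ne (by omega : 1 < #X) a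
    have h1 := hdeg a' a hne (hind a' ha' a ha)
    have h2 := hle a' ha'
    exact adj_of_degree_le _ (hsub a ha) (by omega) (Finset.mem_compl.2 hb)
  have hsub' : ∀ b ∉ X, X ⊆ G.neighborFinset b := by
    intro b hb a ha
    rw [mem_neighborFinset]
    exact (hadj a ha b hb).symm
  have hge : ∀ b ∉ X, m ≤ G.degree b := by
    intro b hb
    rw [← card_neighborFinset_eq_degree, ← hXm]
    exact card_le_card (hsub' b hb)
  have hnbr : ∀ a ∉ X, ∀ b ∉ X, a ≠ b → ¬G.Adj a b → ∀ d, G.Adj a d → d ∈ X := by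
    intro a ha b hb hab hnadj d hd
    have h1 := hdeg a b hab hnadj
    have h2 := hge b hb
    have h3 : X = G.neighborFinset a := Finset.eq_of_subset_of_card_le (hsub' a ha) (by
      rw [card_neighborFinset_eq_degree]; omega)
    rw [h3, mem_neighborFinset]
    exact hd
  refine ⟨hadj, ?_⟩
  by_contra! hcon
  obtain ⟨⟨a, ha, b, hb, hab, hnadj⟩, d, hd, e, he, hde⟩ := hcon
  have hda : d ≠ a := by
    rintro rfl
    exact he (hnbr d hd b hb hab hnadj e hde)
  refine he (hnbr d hd a ha hda (fun h => hd (hnbr a ha b hb hab hnadj d h.symm)) e hde)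

lemma nonempty_iso_of_independent [Fintype V] {G : SimpleGraph V} {m : ℕ}
    (hcard : Fintype.card V = 2 * m) {X : Finset V} (hXm : #X = m)
    (hind : ∀ a ∈ X, ∀ b ∈ X, ¬G.Adj a b) (hadj : ∀ a ∈ X, ∀ b ∉ X, G.Adj a b)
    (hY : (∀ a ∉ X, ∀ b ∉ X, a ≠ b → G.Adj a b) ∨ ∀ a ∉ X, ∀ b ∉ X, ¬G.Adj a b) :
    Nonempty (G ≃g graphJoin (⊤ : SimpleGraph (Fin m)) (⊥ : SimpleGraph (Fin m))) ∨
      Nonempty (G ≃g completeBipartiteGraph (Fin m) (Fin m)) := by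
  have eX : {x // x ∈ X} ≃ Fin m := Fintype.equivFinOfCardEq (by simpa using hXm)
  have eY : {x // ¬x ∈ X} ≃ Fin m := Fintype.equivFinOfCardEq (by
    rw [Fintype.card_subtype_compl, hcard]; simp [hXm]; omega)
  obtain ⟨e, hl, hr⟩ : ∃ e : Fin m ⊕ Fin m ≃ V, (∀ i, e (.inl i) ∉ X) ∧ ∀ i, e (.inr i) ∈ X :=
    ⟨(Equiv.sumComm _ _).trans ((Equiv.sumCongr eX.symm eY.symm).trans
      (Equiv.sumCompl (fun x => x ∈ X))), fun i => (eY.symm i).2, fun i => (eX.symm i).2⟩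
  rcases hY with hY | hY
  · refine Or.inl ⟨(⟨e, ?_⟩ : graphJoin ⊤ ⊥ ≃g G).symm⟩
    rintro (i | i) (j | j)
    · by_cases hij : i = j
      · simp [hij]
      · have := hY _ (hl i) _ (hl j) (by simpa using hij)
        simp [graphJoin, this, hij]
    · simp [graphJoin, (hadj _ (hr j) _ (hl i)).symm]
    · simp [graphJoin, hadj _ (hr i) _ (hl j)]
    · simp [graphJoin, hind _ (hr i) _ (hr j)]
  · refine Or.inr ⟨(⟨e, ?_⟩ : completeBipartiteGraph _ _ ≃g G).symm⟩
    rintro (i | i) (j | j)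
    · simp [hY _ (hl i) _ (hl j)]
    · simp [(hadj _ (hr j) _ (hl i)).symm]
    · simp [hadj _ (hr i) _ (hl j)]
    · simp [hind _ (hr i) _ (hr j)]

lemma exists_independent_of_iso {G : SimpleGraph V} {m : ℕ}
    (h : Nonempty (G ≃g graphJoin (⊤ : SimpleGraph (Fin m)) (⊥ : SimpleGraph (Fin m))) ∨
      Nonempty (G ≃g completeBipartiteGraph (Fin m) (Fin m))) :
    ∃ X : Finset V, #X = m ∧ (∀ a ∈ X, ∀ b ∈ X, ¬G.Adj a b) ∧ ∀ a ∈ X, ∀ b ∉ X, G.Adj a b := by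
  obtain ⟨e, h1, h2⟩ : ∃ e : V ≃ Fin m ⊕ Fin m,
      (∀ i j, ¬G.Adj (e.symm (.inr i)) (e.symm (.inr j))) ∧
        ∀ i j, G.Adj (e.symm (.inr i)) (e.symm (.inl j)) := by
    rcases h with ⟨⟨e⟩⟩ | ⟨⟨e⟩⟩
    · exact ⟨e.toEquiv, fun i j h => by simpa [graphJoin] using e.symm.map_adj_iff.1 h,
        fun i j => e.symm.map_adj_iff.2 (by simp [graphJoin])⟩
    · exact ⟨e.toEquiv, fun i j h => by simpa using e.symm.map_adj_iff.1 h,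
        fun i j => e.symm.map_adj_iff.2 (by simp)⟩
  refine ⟨(univ : Finset (Fin m)).image fun i => e.symm (.inr i), ?_, ?_, ?_⟩
  · exact (card_image_of_injective _ (e.symm.injective.comp Sum.inr_injective)).trans (by simp)
  · simpa using h1
  · simp only [Finset.mem_image, Finset.mem_univ, true_and]
    rintro _ ⟨i, rfl⟩ b hb
    obtain ⟨s, rfl⟩ := e.symm.surjective b
    rcases s with j | j
    · exact h2 i j
    · exact absurd ⟨j, rfl⟩ hb

/-- In a complete bipartite configuration two lists of equal length can be interleaved. -/
lemma exists_isPathList_perm_append {G : SimpleGraph V} :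
    ∀ l₁ l₂ : List V, l₁.length = l₂.length → l₁ ≠ [] → (∀ a ∈ l₁, ∀ b ∈ l₂, G.Adj a b) →
      ∃ l, ∃ a ∈ l₁, ∃ b ∈ l₂, IsPathList G.Adj a b l ∧ l.Perm (l₁ ++ l₂)
  | [], _, _, h, _ => absurd rfl h
  | _ :: _, [], h, _, _ => by simp at h
  | a :: l₁, b :: l₂, hlen, _, hadj => by
    have hab : IsPathList G.Adj a b [a, b] :=
      (IsPathList.singleton _ a).append (.singleton _ b) (hadj a (by simp) b (by simp))
    by_cases hl : l₁ = []
    · subst hl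
      obtain rfl : l₂ = [] := by simpa using hlen.symm
      exact ⟨[a, b], a, by simp, b, by simp, hab, List.Perm.refl _⟩
    · obtain ⟨l, a', ha', b', hb', hl', hperm⟩ := exists_isPathList_perm_append l₁ l₂
        (by simpa using hlen) hl
        fun a ha b hb => hadj a (List.mem_cons_of_mem _ ha) b (List.mem_cons_of_mem _ hb)
      refine ⟨[a, b] ++ l, a, by simp, b', List.mem_cons_of_mem _ hb',
        hab.append hl' (hadj a' (List.mem_cons_of_mem _ ha') b (by simp)).symm, ?_⟩
      simp only [List.cons_append, List.nil_append]
      exact List.Perm.cons a ((hperm.cons b).trans List.perm_middle.symm)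

lemma isHForceSet_of_independent [Fintype V] [DecidableEq V] {G : SimpleGraph V} {m : ℕ}
    (hm : 0 < m) (hcard : Fintype.card V = 2 * m) {X : Finset V} (hXm : #X = m)
    (hind : ∀ a ∈ X, ∀ b ∈ X, ¬G.Adj a b) : IsHForceSet G X := by
  refine ⟨Finset.card_pos.1 (by omega), fun v c hc hXc => ?_⟩
  rw [Walk.isHamiltonianCycle_iff_isCycle_and_length_eq]
  refine ⟨hc, le_antisymm ?_ ?_⟩
  · have := hc.support_nodup.length_le_card
    simpa using this
  have hcount : m ≤ c.support.tail.countP (· ∈ X) := by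
    rw [List.countP_eq_length_filter, ← hXm]
    refine le_trans (card_le_card fun x hx => ?_)
      (List.toFinset_card_le (c.support.tail.filter (· ∈ X)))
    rw [List.mem_toFinset, List.mem_filter]
    refine ⟨?_, by simpa using hx⟩
    have := hXc x hx
    rw [← Walk.cons_tail_support, List.mem_cons] at this
    rcases this with rfl | h
    · exact Walk.end_mem_tail_support hc.not_nil
    · exact h
  have h1 : c.darts.countP (fun d => d.fst ∈ X) = c.support.tail.countP (· ∈ X) := by
    rw [c.tail_support_perm_dropLast_support.countP_eq, ← Walk.map_fst_darts, List.countP_map]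
    rfl
  have h2 : c.darts.countP (fun d => d.snd ∈ X) = c.support.tail.countP (· ∈ X) := by
    rw [← Walk.map_snd_darts, List.countP_map]
    rfl
  have h3 : c.darts.countP (fun d => d.snd ∈ X) ≤ c.darts.countP (fun d => ¬d.fst ∈ X) := by
    refine List.countP_mono_left fun d _ hd => ?_
    simp only [decide_eq_true_eq] at hd ⊢
    exact fun h => hind _ h _ hd d.adj
  have h4 := List.length_eq_countP_add_countP (fun d : G.Dart => decide (d.fst ∈ X)) (l := c.darts)
  rw [Walk.length_darts] at h4
  simp only [decide_eq_true_eq] at h4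
  omega

lemma hForce_eq_of_independent [Fintype V] [DecidableEq V] {G : SimpleGraph V} {m : ℕ}
    (hm : 3 ≤ m) (hcard : Fintype.card V = 2 * m) {X : Finset V} (hXm : #X = m)
    (hind : ∀ a ∈ X, ∀ b ∈ X, ¬G.Adj a b) (hadj : ∀ a ∈ X, ∀ b ∉ X, G.Adj a b) :
    hForce G = m := by
  have hmem : m ∈ {k | ∃ X : Finset V, IsHForceSet G X ∧ X.card = k} :=
    ⟨X, isHForceSet_of_independent (by omega) hcard hXm hind, hXm⟩
  refine le_antisymm (Nat.sInf_le hmem) ?_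
  obtain ⟨Z, ⟨-, hZ⟩, hZc⟩ := Nat.sInf_mem ⟨m, hmem⟩
  rw [hForce, ← hZc]
  by_contra! hlt
  have hXc : #Xᶜ = m := by rw [card_compl]; omega
  obtain ⟨x, hxX, hxZ⟩ := Finset.exists_mem_notMem_of_card_lt_card (by omega : #Z < #X)
  obtain ⟨y, hyX, hyZ⟩ := Finset.exists_mem_notMem_of_card_lt_card (by omega : #Z < #Xᶜ)
  have hlX : (X.erase x).toList.length = m - 1 := by
    rw [Finset.length_toList, card_erase_of_mem hxX, hXm]
  have hlY : (Xᶜ.erase y).toList.length = m - 1 := by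
    rw [Finset.length_toList, card_erase_of_mem hyX, hXc]
  obtain ⟨l, a, ha, b, hb, hl, hperm⟩ := exists_isPathList_perm_append (G := G)
    (X.erase x).toList (Xᶜ.erase y).toList (by rw [hlX, hlY])
    (by rw [← List.length_pos_iff]; omega) (by
      intro a ha b hb
      simp only [Finset.mem_toList, Finset.mem_erase, Finset.mem_compl] at ha hb
      exact hadj a ha.2 b hb.2)
  have hmeml : ∀ v, v ∈ l ↔ v ≠ x ∧ v ∈ X ∨ v ≠ y ∧ v ∉ X := by
    intro v
    rw [hperm.mem_iff, List.mem_append]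
    simp
  simp only [Finset.mem_toList, Finset.mem_erase, Finset.mem_compl] at ha hb
  have hC : IsCycleList G l := by
    refine ⟨hperm.nodup_iff.2 ?_, ?_, a, b, hl, (hadj a ha.2 b hb.2).symm⟩
    · refine List.nodup_append.2 ⟨Finset.nodup_toList _, Finset.nodup_toList _, ?_⟩
      rintro u hu v hv rfl
      simp only [Finset.mem_toList, Finset.mem_erase, Finset.mem_compl] at hu hv
      exact hv.2 hu.2
    · rw [hperm.length_eq, List.length_append]; omega
  obtain ⟨v, c, hc, hcl⟩ := hC.exists_isCycle
  have hham := hZ v c hc fun z hz => by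
    rw [hcl, hmeml]
    have h1 : z ≠ x := by rintro rfl; exact hxZ hz
    have h2 : z ≠ y := by rintro rfl; exact hyZ hz
    tauto
  have := hham.mem_support x
  rw [hcl, hmeml] at this
  tauto

end HamiltonianCycles

/-- For the weak closure `Gw` of an OTG with `n ≥ 5` vertices, `h(Gw) = n / 2` iff `n` is even
and `Gw ≅ K_{n/2} ∨ K^c_{n/2}` or `Gw ≅ K_{n/2, n/2}`. -/
theorem stmt_12 {V : Type*} [Fintype V] [DecidableEq V] (Gw : SimpleGraph V) (n : ℕ)
    (hcard : Fintype.card V = n) (hn : 5 ≤ n)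
    (hGw : ∃ G : SimpleGraph V, IsOTG G ∧ IsWeakClosure G Gw) :
    2 * hForce Gw = n ↔
      Even n ∧
        (Nonempty (Gw ≃g graphJoin (⊤ : SimpleGraph (Fin (n / 2)))
            (⊥ : SimpleGraph (Fin (n / 2)))) ∨
         Nonempty (Gw ≃g completeBipartiteGraph (Fin (n / 2)) (Fin (n / 2)))) := by
  obtain ⟨G, hG, hstep, hclosed⟩ := hGw
  have hle : G ≤ Gw := by
    clear hclosed
    induction hstep with
    | refl => exact le_rfl
    | tail _ h ih =>
      obtain ⟨u, v, -, -, -, rfl⟩ := h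
      exact ih.trans le_sup_left
  have hdeg : ∀ u v, u ≠ v → ¬Gw.Adj u v → Gw.degree u + Gw.degree v = n := by
    intro u v huv hnadj
    have h1 := hG.mono hle u v huv hnadj
    have h2 := hclosed u v huv hnadj
    omega
  constructor
  · intro h
    refine ⟨⟨hForce Gw, by omega⟩, ?_⟩
    set m := hForce Gw with hm
    obtain ⟨X, ⟨-, hforce⟩, hXm⟩ : m ∈ {k | ∃ X : Finset V, IsHForceSet Gw X ∧ X.card = k} :=
      Nat.sInf_mem (Nat.nonempty_of_sInf_eq_succ (k := m - 1) (by rw [← hForce, ← hm]; omega))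
    rw [← h] at hdeg hcard ⊢
    have hX : ∀ l, IsCycleList Gw l → (∀ x ∈ X, x ∈ l) → ∀ v, v ∈ l := by
      intro l hl hXl v
      obtain ⟨u, c, hc, hcl⟩ := hl.exists_isCycle
      exact (hcl v).1 ((hforce u c hc fun x hx => (hcl x).2 (hXl x hx)).mem_support v)
    rw [Nat.mul_div_cancel_left m two_pos]
    have hind := (card_eq_and_independent (by omega) hcard hdeg hXm.le hX).2
    obtain ⟨hadj, hY⟩ := adj_of_independent (by omega) hcard hdeg hXm hind
    exact nonempty_iso_of_independent hcard hXm hind hadj hY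
  · rintro ⟨⟨m, hm⟩, hiso⟩
    obtain rfl : n = 2 * m := by omega
    rw [Nat.mul_div_cancel_left m two_pos] at hiso
    obtain ⟨X, hXm, hind, hadj⟩ := exists_independent_of_iso hiso
    rw [hForce_eq_of_independent (by omega) hcard hXm hind hadj]
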